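/- Let B be a unital C*-algebra and let c : [0,∞) → B satisfy c_0 = 1 and c_{s+t} = c_s c_t for all s,t ≥ 0. If for every bounded linear functional φ on B the function t ↦ φ(c_t) is continuous on [0,∞), then t ↦ c_t is continuous in the norm of B on [0,∞). -/

import Mathlib

open scoped NNReal

section WeaklyContinuous

variable {𝕜 X E : Type*} [RCLike 𝕜] [TopologicalSpace X] [NormedAddCommGroup E] [NormedSpace 𝕜 E]
  {f : X → E}

/-- The preimage of a norm closed convex set under a weakly continuous map is closed. -/
theorem isClosed_preimage_of_weakly_continuous [NormedSpace ℝ E] [IsScalarTower ℝ 𝕜 E]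
    (hf : ∀ φ : E →L[𝕜] 𝕜, Continuous fun x => φ (f x)) {K : Set E} (hK : Convex ℝ K)
    (hKc : IsClosed K) : IsClosed (f ⁻¹' K) := by
  rw [← isOpen_compl_iff, isOpen_iff_mem_nhds]
  intro x hx
  obtain ⟨φ, u, hφK, hφx⟩ := RCLike.geometric_hahn_banach_closed_point (𝕜 := 𝕜) hK hKc hx
  have hopen : IsOpen {y | u < RCLike.re (φ (f y))} :=
    isOpen_lt continuous_const (RCLike.continuous_re.comp (hf φ))
  filter_upwards [hopen.mem_nhds hφx] with y hy hyK
  exact lt_asymm hy (hφK _ hyK)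

/-- A weakly continuous map sends the closure of a set into the closed linear span of the image
of that set. -/
theorem mem_closure_span_of_weakly_continuous
    (hf : ∀ φ : E →L[𝕜] 𝕜, Continuous fun x => φ (f x)) {s : Set X} {x : X} (hx : x ∈ closure s) :
    f x ∈ closure (Submodule.span 𝕜 (f '' s) : Set E) := by
  let _ : NormedSpace ℝ E := NormedSpace.restrictScalars ℝ 𝕜 E
  have : IsScalarTower ℝ 𝕜 E := IsScalarTower.restrictScalars ℝ 𝕜 E
  have hconv : Convex ℝ (Submodule.span 𝕜 (f '' s) : Set E) :=
    ((Submodule.span 𝕜 (f '' s)).restrictScalars ℝ).convex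
  exact closure_minimal (t := f ⁻¹' closure (Submodule.span 𝕜 (f '' s) : Set E))
    (fun y hy => subset_closure (Submodule.subset_span (Set.mem_image_of_mem f hy)))
    (isClosed_preimage_of_weakly_continuous hf hconv.closure isClosed_closure) hx

/-- A weakly continuous map on a separable Baire space is norm continuous at a dense set of
points. -/
theorem dense_continuousAt_of_weakly_continuous [BaireSpace X] [TopologicalSpace.SeparableSpace X]
    (hf : ∀ φ : E →L[𝕜] 𝕜, Continuous fun x => φ (f x)) : Dense {x | ContinuousAt f x} := by
  let _ : NormedSpace ℝ E := NormedSpace.restrictScalars ℝ 𝕜 E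
  have : IsScalarTower ℝ 𝕜 E := IsScalarTower.restrictScalars ℝ 𝕜 E
  obtain ⟨s, hs, hsd⟩ := TopologicalSpace.exists_countable_dense X
  obtain ⟨D, hD, hDs⟩ := ((hs.image f).isSeparable.span (R := 𝕜)).closure
  have := hD.to_subtype
  have hfD (x : X) : f x ∈ closure D := hDs (mem_closure_span_of_weakly_continuous hf (hsd x))
  let U (n : ℕ) : Set X := ⋃ b : D, interior (f ⁻¹' Metric.closedBall (b : E) (1 / (n + 1 : ℝ)))
  have hUo (n : ℕ) : IsOpen (U n) := isOpen_iUnion fun _ => isOpen_interior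
  have hUd (n : ℕ) : Dense (U n) := by
    refine dense_iUnion_interior_of_closed (fun b => isClosed_preimage_of_weakly_continuous hf
      (convex_closedBall _ _) Metric.isClosed_closedBall) (Set.eq_univ_of_forall fun x => ?_)
    obtain ⟨b, hb, hxb⟩ := Metric.mem_closure_iff.1 (hfD x) _ (Nat.one_div_pos_of_nat (n := n))
    exact Set.mem_iUnion.2 ⟨⟨b, hb⟩, hxb.le⟩
  refine (dense_iInter_of_isOpen_nat hUo hUd).mono fun x hx => ?_
  refine Metric.continuousAt_iff'.2 fun ε hε => ?_
  obtain ⟨n, hn⟩ := exists_nat_one_div_lt (half_pos hε)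
  obtain ⟨b, hb⟩ := Set.mem_iUnion.1 (Set.mem_iInter.1 hx n)
  have hball := mem_interior_iff_mem_nhds.1 hb
  have hxb := mem_of_mem_nhds hball
  rw [Set.mem_preimage, Metric.mem_closedBall] at hxb
  filter_upwards [hball] with y hy
  have hyb : dist (f y) b ≤ 1 / (n + 1 : ℝ) := hy
  linarith [dist_triangle_right (f y) (f x) b]

end WeaklyContinuous

/-- A semigroup which is continuous at a dense set of times is continuous at all positive times. -/
theorem continuousAt_of_dense_continuousAt {M : Type*} [Mul M] [TopologicalSpace M]
    [ContinuousMul M] {c : ℝ≥0 → M} (hmul : ∀ s t, c (s + t) = c s * c t)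
    (hd : Dense {t | ContinuousAt c t}) {t : ℝ≥0} (ht : 0 < t) : ContinuousAt c t := by
  obtain ⟨r, hr, hr0, hrt⟩ := hd.exists_between ht
  have hsub : t - (t - r) = r := tsub_tsub_cancel_of_le hrt.le
  have hshift : ContinuousAt (fun s => c (s - (t - r)) * c (t - r)) t := by
    refine ContinuousAt.mul (ContinuousAt.comp (g := c) ?_ (by fun_prop)) continuousAt_const
    rwa [hsub]
  refine hshift.congr ?_
  filter_upwards [Ioi_mem_nhds (tsub_lt_self ht hr0)] with s hs
  rw [← hmul, tsub_add_cancel_of_le (le_of_lt hs)]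

/-- A one-parameter semigroup `c` in a unital C*-algebra `B`
(`c 0 = 1`, `c (s+t) = c s * c t`) which is weakly continuous (i.e. `t ↦ φ (c t)` is
continuous for every bounded linear functional `φ` on `B`) is norm continuous. -/
theorem weakly_continuous_semigroup_norm_continuous {B : Type*} [CStarAlgebra B]
    (c : ℝ≥0 → B) (h0 : c 0 = 1) (hmul : ∀ s t, c (s + t) = c s * c t)
    (hweak : ∀ φ : B →L[ℂ] ℂ, Continuous fun t => φ (c t)) :
    Continuous c := by
  have hpos {t : ℝ≥0} (ht : 0 < t) : ContinuousAt c t :=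
    continuousAt_of_dense_continuousAt hmul (dense_continuousAt_of_weakly_continuous hweak) ht
  have hone : (1 : B) ∈ closure (Submodule.span ℂ (c '' Set.Ioi 0) : Set B) := by
    rw [← h0]
    exact mem_closure_span_of_weakly_continuous hweak (by simp [closure_Ioi])
  obtain ⟨x, hxu, hx⟩ := mem_closure_iff.1 hone _ Units.isOpen isUnit_one
  have horbit : ContinuousAt (fun t => c t * x) 0 := by
    clear hxu
    induction hx using Submodule.span_induction with
    | mem y hy =>
      obtain ⟨s, hs, rfl⟩ := hy
      simp_rw [← hmul]
      refine ContinuousAt.comp (g := c) ?_ (by fun_prop)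
      simpa using hpos hs
    | zero => simpa using continuousAt_const
    | add y z _ _ hy hz =>
      simp_rw [mul_add]
      exact hy.add hz
    | smul a y _ hy =>
      simp_rw [mul_smul_comm]
      exact hy.const_smul a
  refine continuous_iff_continuousAt.2 fun t => ?_
  rcases eq_zero_or_pos t with rfl | ht
  · obtain ⟨u, rfl⟩ := hxu
    refine (horbit.mul (continuousAt_const (y := (↑u⁻¹ : B)))).congr (.of_forall fun s => ?_)
    simp
  · exact hpos ht
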